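/- (Theorem 1) Let G be the presented group on generators x_{ij}, indexed by pairs with 1 ≤ i < j, i ≤ m+n−1, m+1 ≤ j ≤ m+n, subject to the relations (P1) x_{ij}⁻¹ x_{rs} x_{ij} = x_{rs} if i<j<r<s or r<i<j<s, (P2) x_{ij}⁻¹ x_{js} x_{ij} = x_{is} x_{js} x_{is}⁻¹ if i<j<s, (P3) x_{ij}⁻¹ x_{is} x_{ij} = x_{is} x_{js} x_{is} x_{js}⁻¹ x_{is}⁻¹ if i<j<s, (P4) x_{ij}⁻¹ x_{rs} x_{ij} = x_{is} x_{js} x_{is}⁻¹ x_{js}⁻¹ x_{rs} x_{js} x_{is} x_{js}⁻¹ x_{is}⁻¹ if i<r<j<s (all indices ranging over the index set). Then there is a group isomorphism from G onto P_{m,n} sending each generator x_{ij} to a_{ij}. -/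

import Mathlib

open FreeGroup

namespace BraidPaper

/-- Relators for the Artin braid group on generators `σ_1, …, σ_n`
(so this presents the braid group `B_{n+1}`); the generator with index `k : Fin n`
represents `σ_{k+1}`. -/
def braidRels (n : ℕ) : Set (FreeGroup (Fin n)) :=
  {x | ∃ k l : Fin n, ((k : ℕ) + 2 ≤ (l : ℕ) ∨ (l : ℕ) + 2 ≤ (k : ℕ)) ∧
      x = of k * of l * (of k)⁻¹ * (of l)⁻¹} ∪
  {x | ∃ k l : Fin n, (l : ℕ) = (k : ℕ) + 1 ∧
      x = of k * of l * of k * (of l)⁻¹ * (of k)⁻¹ * (of l)⁻¹}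

/-- The braid group with `n` generators `σ_1, …, σ_n`, i.e. the Artin braid group
`B_{n+1}`.  Thus `B_N = BraidGroup (N-1)`. -/
abbrev BraidGroup (n : ℕ) : Type := PresentedGroup (braidRels n)

/-- The generator `σ_k` (1-based) of `BraidGroup n`, for `1 ≤ k ≤ n`. -/
def sgen (n k : ℕ) : BraidGroup n :=
  if h : 1 ≤ k ∧ k ≤ n then PresentedGroup.of ⟨k - 1, by omega⟩ else 1

/-- The descending product `σ_{j-1} σ_{j-2} ⋯ σ_{i+1}`. -/
def dprod (n i j : ℕ) : BraidGroup n :=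
  ((List.range (j - 1 - i)).map fun t => sgen n (j - 1 - t)).prod

/-- The pure braid generator
`a_{ij} = σ_{j-1} σ_{j-2} ⋯ σ_{i+1} σ_i² σ_{i+1}⁻¹ ⋯ σ_{j-2}⁻¹ σ_{j-1}⁻¹`. -/
def agen (n i j : ℕ) : BraidGroup n := dprod n i j * (sgen n i) ^ 2 * (dprod n i j)⁻¹
/-- The generating set of the mixed braid group `B_{m,n} ≤ B_{m+n}`:
the pure generators `a_{ij}` with `1 ≤ i < j`, `m+1 ≤ j ≤ m+n`, together with
the crossings `σ_{m+1}, …, σ_{m+n-1}` among the last `n` strands. -/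
def BmnSet (m n : ℕ) : Set (BraidGroup (m + n - 1)) :=
  {x | ∃ i j : ℕ, 1 ≤ i ∧ i < j ∧ m + 1 ≤ j ∧ j ≤ m + n ∧ x = agen (m + n - 1) i j} ∪
  {x | ∃ k : ℕ, m + 1 ≤ k ∧ k ≤ m + n - 1 ∧ x = sgen (m + n - 1) k}

/-- The mixed braid group `B_{m,n}`, as a subgroup of `B_{m+n}`. -/
def Bmn (m n : ℕ) : Subgroup (BraidGroup (m + n - 1)) := Subgroup.closure (BmnSet m n)
/-- Index set for the generators `x_{ij}` of the presentation of `P_{m,n}`: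
pairs `(i,j)` with `1 ≤ i < j`, `m+1 ≤ j ≤ m+n` (hence `i ≤ m+n-1`). -/
def PureIdx (m n : ℕ) : Type :=
  {p : ℕ × ℕ // 1 ≤ p.1 ∧ p.1 < p.2 ∧ m + 1 ≤ p.2 ∧ p.2 ≤ m + n}

/-- The relators P1–P4 of Theorem 1, as words in the free group on `PureIdx m n`. -/
def pureRels (m n : ℕ) : Set (FreeGroup (PureIdx m n)) :=
  -- (P1)  x_{ij}⁻¹ x_{rs} x_{ij} = x_{rs}  if  i<j<r<s  or  r<i<j<s
  {x | ∃ p q : PureIdx m n,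
      (p.1.2 < q.1.1 ∨ (q.1.1 < p.1.1 ∧ p.1.2 < q.1.2)) ∧
      x = (of p)⁻¹ * of q * of p * (of q)⁻¹} ∪
  -- (P2)  x_{ij}⁻¹ x_{js} x_{ij} = x_{is} x_{js} x_{is}⁻¹  if  i<j<s
  {x | ∃ i j s : ℕ, ∃ _h : 1 ≤ i ∧ i < j ∧ m + 1 ≤ j ∧ j < s ∧ s ≤ m + n,
      x = (of (⟨(i, j), by omega⟩ : PureIdx m n))⁻¹ * of (⟨(j, s), by omega⟩ : PureIdx m n) *
            of (⟨(i, j), by omega⟩ : PureIdx m n) *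
          (of (⟨(i, s), by omega⟩ : PureIdx m n) * of (⟨(j, s), by omega⟩ : PureIdx m n) *
            (of (⟨(i, s), by omega⟩ : PureIdx m n))⁻¹)⁻¹} ∪
  -- (P3)  x_{ij}⁻¹ x_{is} x_{ij} = x_{is} x_{js} x_{is} x_{js}⁻¹ x_{is}⁻¹  if  i<j<s
  {x | ∃ i j s : ℕ, ∃ _h : 1 ≤ i ∧ i < j ∧ m + 1 ≤ j ∧ j < s ∧ s ≤ m + n,
      x = (of (⟨(i, j), by omega⟩ : PureIdx m n))⁻¹ * of (⟨(i, s), by omega⟩ : PureIdx m n) *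
            of (⟨(i, j), by omega⟩ : PureIdx m n) *
          (of (⟨(i, s), by omega⟩ : PureIdx m n) * of (⟨(j, s), by omega⟩ : PureIdx m n) *
            of (⟨(i, s), by omega⟩ : PureIdx m n) * (of (⟨(j, s), by omega⟩ : PureIdx m n))⁻¹ *
            (of (⟨(i, s), by omega⟩ : PureIdx m n))⁻¹)⁻¹} ∪
  -- (P4)  x_{ij}⁻¹ x_{rs} x_{ij} = x_{is} x_{js} x_{is}⁻¹ x_{js}⁻¹ x_{rs} x_{js} x_{is} x_{js}⁻¹ x_{is}⁻¹
  --       if  i<r<j<s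
  {x | ∃ i r j s : ℕ, ∃ _h : 1 ≤ i ∧ i < r ∧ r < j ∧ m + 1 ≤ j ∧ j < s ∧ s ≤ m + n,
      x = (of (⟨(i, j), by omega⟩ : PureIdx m n))⁻¹ * of (⟨(r, s), by omega⟩ : PureIdx m n) *
            of (⟨(i, j), by omega⟩ : PureIdx m n) *
          (of (⟨(i, s), by omega⟩ : PureIdx m n) * of (⟨(j, s), by omega⟩ : PureIdx m n) *
            (of (⟨(i, s), by omega⟩ : PureIdx m n))⁻¹ * (of (⟨(j, s), by omega⟩ : PureIdx m n))⁻¹ *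
            of (⟨(r, s), by omega⟩ : PureIdx m n) *
            of (⟨(j, s), by omega⟩ : PureIdx m n) * of (⟨(i, s), by omega⟩ : PureIdx m n) *
            (of (⟨(j, s), by omega⟩ : PureIdx m n))⁻¹ * (of (⟨(i, s), by omega⟩ : PureIdx m n))⁻¹)⁻¹}

section BraidRelations

variable {N : ℕ}

theorem sgen_comm {k l : ℕ} (h : k + 2 ≤ l) : Commute (sgen N k) (sgen N l) := by
  unfold sgen
  split_ifs with hk hl
  · have hr : of (⟨k - 1, by omega⟩ : Fin N) * of (⟨l - 1, by omega⟩ : Fin N) *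
        (of (⟨k - 1, by omega⟩ : Fin N))⁻¹ * (of (⟨l - 1, by omega⟩ : Fin N))⁻¹ ∈ braidRels N :=
      Or.inl ⟨_, _, Or.inl (by simp only; omega), rfl⟩
    have h1 := PresentedGroup.one_of_mem hr
    exact mul_inv_eq_iff_eq_mul.mp (mul_inv_eq_one.mp h1)
  · exact Commute.one_right _
  · exact Commute.one_left _
  · exact Commute.one_left _

theorem sgen_braid {k : ℕ} (hk : 1 ≤ k) (hN : k + 1 ≤ N) :
    sgen N k * sgen N (k + 1) * sgen N k = sgen N (k + 1) * sgen N k * sgen N (k + 1) := by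
  unfold sgen
  rw [dif_pos (by omega), dif_pos (by omega)]
  have hr : of (⟨k - 1, by omega⟩ : Fin N) * of (⟨k + 1 - 1, by omega⟩ : Fin N) *
      of (⟨k - 1, by omega⟩ : Fin N) * (of (⟨k + 1 - 1, by omega⟩ : Fin N))⁻¹ *
      (of (⟨k - 1, by omega⟩ : Fin N))⁻¹ * (of (⟨k + 1 - 1, by omega⟩ : Fin N))⁻¹ ∈ braidRels N :=
    Or.inr ⟨_, _, by simp only; omega, rfl⟩
  have h1 := PresentedGroup.one_of_mem hr
  exact mul_inv_eq_iff_eq_mul.mp (mul_inv_eq_iff_eq_mul.mp (mul_inv_eq_one.mp h1))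

theorem dprod_self_succ (i : ℕ) : dprod N i (i + 1) = 1 := by simp [dprod]

theorem dprod_succ {i j : ℕ} (h : i < j) : dprod N i (j + 1) = sgen N j * dprod N i j := by
  unfold dprod
  rw [show j + 1 - 1 - i = (j - 1 - i) + 1 by omega, List.range_succ_eq_map, List.map_cons,
    List.prod_cons, List.map_map]
  congr 2
  refine List.map_congr_left fun t _ => ?_
  simp only [Function.comp_apply, Nat.succ_eq_add_one]
  congr 1
  omega

theorem agen_self_succ (i : ℕ) : agen N i (i + 1) = sgen N i ^ 2 := by
  simp [agen, dprod_self_succ]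

theorem agen_succ {i j : ℕ} (h : i < j) :
    agen N i (j + 1) = sgen N j * agen N i j * (sgen N j)⁻¹ := by
  simp only [agen, dprod_succ h]
  group

theorem agen_succ_conj {i j : ℕ} (h : i < j) :
    agen N i (j + 1) = MulAut.conj (sgen N j) (agen N i j) := agen_succ h

theorem conj_eq_self_of_commute {G : Type*} [Group G] {g x : G} (h : Commute g x) :
    MulAut.conj g x = x := by
  rw [MulAut.conj_apply, h.eq, mul_inv_cancel_right]

theorem dprod_comm {i j k : ℕ} (h : i < j) (hk : k + 1 ≤ i ∨ j + 1 ≤ k) :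
    Commute (sgen N k) (dprod N i j) := by
  induction j, h using Nat.le_induction with
  | base => rw [Nat.succ_eq_add_one, dprod_self_succ]; exact Commute.one_right _
  | succ j hj ih =>
    rw [dprod_succ hj]
    refine Commute.mul_right ?_ (ih (by omega))
    rcases hk with hk | hk
    · exact sgen_comm (by omega)
    · exact (sgen_comm (by omega)).symm

theorem agen_comm_outer {i j k : ℕ} (h : i < j) (hk : k + 2 ≤ i ∨ j + 1 ≤ k) :
    Commute (sgen N k) (agen N i j) := by
  have hd := dprod_comm (N := N) h (k := k) (by omega)
  refine (hd.mul_right (Commute.pow_right ?_ 2)).mul_right hd.inv_right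
  rcases hk with hk | hk
  · exact sgen_comm hk
  · exact (sgen_comm (by omega)).symm

theorem commute_of_braid {G : Type*} [Group G] {s t x : G} (h : s * t * s = t * s * t)
    (hx : Commute t x) : Commute s (t * (s * x * s⁻¹) * t⁻¹) := by
  have e : t * (s * x * s⁻¹) * t⁻¹ = (t * s) * x * (t * s)⁻¹ := by group
  have e1 : s * (t * s) = (t * s) * t := by rw [← mul_assoc, h]
  have e2 : (t * s)⁻¹ * s = t * (t * s)⁻¹ := by
    rw [inv_mul_eq_iff_eq_mul, ← mul_assoc, ← e1, mul_inv_cancel_right]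
  rw [e, Commute, SemiconjBy]
  calc s * (t * s * x * (t * s)⁻¹) = s * (t * s) * x * (t * s)⁻¹ := by group
    _ = (t * s) * (t * x) * (t * s)⁻¹ := by rw [e1]; group
    _ = (t * s) * x * (t * (t * s)⁻¹) := by rw [hx.eq]; group
    _ = _ := by rw [← e2]; group

theorem agen_comm_inner {i j k : ℕ} (hi : 1 ≤ i) (hik : i < k) (hkj : k + 1 < j)
    (hN : j ≤ N + 1) : Commute (sgen N k) (agen N i j) := by
  induction j, (show k + 2 ≤ j by omega) using Nat.le_induction with
  | base =>
    rw [agen_succ (by omega), agen_succ hik]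
    exact commute_of_braid (sgen_braid (by omega) (by omega)) (agen_comm_outer hik (by omega))
  | succ j hj ih =>
    rw [agen_succ (by omega)]
    have h := sgen_comm (N := N) (show k + 2 ≤ j by omega)
    exact (h.mul_right (ih (by omega) (by omega))).mul_right h.inv_right

theorem agen_comm {i j k : ℕ} (hi : 1 ≤ i) (hij : i < j) (hN : j ≤ N + 1)
    (hk : k + 1 < i ∨ (i < k ∧ k + 1 < j) ∨ j < k) : Commute (sgen N k) (agen N i j) := by
  rcases hk with hk | hk | hk
  · exact agen_comm_outer hij (by omega)
  · exact agen_comm_inner hi hk.1 hk.2 hN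
  · exact agen_comm_outer hij (by omega)

theorem conj_sq_of_braid {G : Type*} [Group G] {a b : G} (h : a * b * a = b * a * b) :
    a * (b * a ^ 2 * b⁻¹) * a⁻¹ = b ^ 2 := by
  have e : a * b * a * (a * b)⁻¹ = b := by rw [h]; group
  calc _ = (a * b * a * (a * b)⁻¹) ^ 2 := by rw [conj_pow]; group
    _ = _ := by rw [e]

/-- Conjugation by `σ_i` shifts the lower index of `a_{ij}`. -/
theorem sgen_conj_agen {i j : ℕ} (hi : 1 ≤ i) (hij : i + 1 < j) (hN : j ≤ N + 1) :
    MulAut.conj (sgen N i) (agen N i j) = agen N (i + 1) j := by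
  induction j, (show i + 2 ≤ j by omega) using Nat.le_induction with
  | base =>
    rw [agen_succ (by omega), agen_self_succ, agen_self_succ, MulAut.conj_apply]
    exact conj_sq_of_braid (sgen_braid hi (by omega))
  | succ j hj ih =>
    rw [agen_succ_conj (by omega), agen_succ_conj (by omega), ← ih (by omega) (by omega)]
    have h := sgen_comm (N := N) (show i + 2 ≤ j by omega)
    rw [← MulAut.mul_apply, ← MulAut.mul_apply, ← _root_.map_mul, ← _root_.map_mul, h.eq]

/-- Conjugation by the square of `σ_{j-1}`, seen on `a_{i,j-1}`. -/
theorem sgen_conj_eq {k : ℕ} (x : BraidGroup N) :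
    sgen N k * x * (sgen N k)⁻¹ =
      agen N k (k + 1) * ((sgen N k)⁻¹ * x * sgen N k) * (agen N k (k + 1))⁻¹ := by
  rw [agen_self_succ]
  group

/-- `a_{ij}` and `σ_j` satisfy the four-term braid relation of type `B`. -/
theorem agen_sgen_braid {i j : ℕ} (hi : 1 ≤ i) (hij : i < j) (hN : j ≤ N) :
    agen N i j * sgen N j * agen N i j * sgen N j =
      sgen N j * agen N i j * sgen N j * agen N i j := by
  obtain ⟨d, rfl⟩ := Nat.exists_eq_add_of_lt hij
  induction d generalizing i with
  | zero =>
    rw [add_zero, agen_self_succ]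
    have h := sgen_braid (N := N) hi (by omega)
    generalize sgen N i = a at *
    generalize sgen N (i + 1) = b at *
    have h1 : a * (b * a * a * b) = (b * a * a * b) * a := by
      calc a * (b * a * a * b) = (a * b * a) * a * b := by group
        _ = b * a * (b * a * b) := by rw [h]; group
        _ = b * a * a * b * a := by rw [← h]; group
    calc _ = a * (a * (b * a * a * b)) := by simp only [sq]; group
      _ = (b * a * a * b) * a * a := by rw [h1, ← mul_assoc, h1]
      _ = _ := by simp only [sq]; group
  | succ d ih =>
    have e := ih (i := i + 1) (by omega) (by omega) (by omega)
    rw [show i + 1 + d + 1 = i + (d + 1) + 1 by omega] at e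
    have hc := conj_eq_self_of_commute
      (sgen_comm (N := N) (show i + 2 ≤ i + (d + 1) + 1 by omega))
    apply (MulAut.conj (sgen N i)).injective
    have hs := sgen_conj_agen (N := N) hi (show i + 1 < i + (d + 1) + 1 by omega) (by omega)
    simpa only [_root_.map_mul, hc, hs] using e

theorem agen_triple {i j s : ℕ} (hi : 1 ≤ i) (hij : i < j) (hjs : j < s) (hN : s ≤ N + 1) :
    agen N i j * (agen N i s * agen N j s) = agen N i s * agen N j s * agen N i j ∧
    agen N j s * agen N i j * agen N i s = agen N i j * agen N i s * agen N j s := by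
  induction s, (show j + 1 ≤ s by omega) using Nat.le_induction with
  | base =>
    rw [agen_succ hij, agen_self_succ]
    have h := agen_sgen_braid hi hij (by omega : j ≤ N)
    generalize sgen N j = b at *
    generalize agen N i j = x at *
    constructor
    · calc _ = x * b * x * b := by simp only [sq]; group
        _ = b * x * b * x := h
        _ = _ := by simp only [sq]; group
    · calc _ = b * (b * x * b * x) * b⁻¹ := by simp only [sq]; group
        _ = b * (x * b * x * b) * b⁻¹ := by rw [h]
        _ = b * x * b * x := by group
        _ = x * b * x * b := h.symm
        _ = _ := by simp only [sq]; group
  | succ s hs ih =>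
    have hc := conj_eq_self_of_commute
      (agen_comm (N := N) hi hij (by omega) (k := s) (by omega))
    obtain ⟨h1, h2⟩ := ih (by omega) (by omega)
    have h1' := congrArg (MulAut.conj (sgen N s)) h1
    have h2' := congrArg (MulAut.conj (sgen N s)) h2
    simp only [_root_.map_mul, hc, ← agen_succ_conj (show i < s by omega),
      ← agen_succ_conj (show j < s by omega)] at h1' h2'
    exact ⟨h1', h2'⟩

theorem agen_commute_of_sgen {i j : ℕ} (hij : i < j) (x : BraidGroup N)
    (h : ∀ k, i ≤ k → k < j → Commute (sgen N k) x) : Commute (agen N i j) x := by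
  induction j, hij using Nat.le_induction with
  | base =>
    rw [Nat.succ_eq_add_one, agen_self_succ]
    exact (h i le_rfl (by omega)).pow_left 2
  | succ j hj ih =>
    rw [agen_succ hj]
    have hc := h j (by omega) (by omega)
    exact (hc.mul_left (ih fun k h1 h2 => h k h1 (by omega))).mul_left hc.inv_left

theorem agen_commute_far {i j r s : ℕ} (hi : 1 ≤ i) (hij : i < j) (hjr : j < r) (hrs : r < s)
    (hN : s ≤ N + 1) : Commute (agen N i j) (agen N r s) :=
  agen_commute_of_sgen hij _ fun _ _ _ => agen_comm (by omega) hrs hN (by omega)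

theorem agen_commute_nested {i j r s : ℕ} (hr : 1 ≤ r) (hri : r < i) (hij : i < j) (hjs : j < s)
    (hN : s ≤ N + 1) : Commute (agen N i j) (agen N r s) :=
  agen_commute_of_sgen hij _ fun _ _ _ => agen_comm hr (by omega) hN (by omega)

theorem agen_commute_crossed {i r j s : ℕ} (hi : 1 ≤ i) (hir : i < r) (hrj : r < j) (hjs : j < s)
    (hN : s ≤ N + 1) :
    Commute (agen N r s) (agen N j s * agen N i j * (agen N j s)⁻¹) := by
  induction s, (show j + 1 ≤ s by omega) using Nat.le_induction with
  | base =>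
    have h := agen_commute_nested hi hir hrj (show j < j + 1 by omega) hN
    have h' := congrArg (MulAut.conj (sgen N j)) h.eq
    simp only [_root_.map_mul, ← agen_succ_conj hrj] at h'
    have e : agen N j (j + 1) * agen N i j * (agen N j (j + 1))⁻¹ =
        MulAut.conj (sgen N j) (agen N i (j + 1)) := by
      rw [agen_self_succ, agen_succ (by omega), MulAut.conj_apply, sq]
      simp only [mul_assoc, mul_inv_rev]
    rw [e]
    exact h'
  | succ s hs ih =>
    have hc := conj_eq_self_of_commute
      (agen_comm (N := N) hi (show i < j by omega) (by omega) (k := s) (by omega))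
    have h' := congrArg (MulAut.conj (sgen N s)) (ih (by omega) (by omega)).eq
    simp only [_root_.map_mul, _root_.map_inv, hc, ← agen_succ_conj (show r < s by omega),
      ← agen_succ_conj (show j < s by omega)] at h'
    exact h'

end BraidRelations

section ArtinAction

/-- The substitution `y_k ↦ y_{k+1}`, `y_{k+1} ↦ y_{k+1}⁻¹ y_k y_{k+1}` of the free group. -/
def artinHom (k : ℕ) : FreeGroup ℕ →* FreeGroup ℕ :=
  FreeGroup.lift fun t =>
    if t = k then of (k + 1) else if t = k + 1 then (of (k + 1))⁻¹ * of k * of (k + 1) else of t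

/-- The inverse of `artinHom`. -/
def artinInvHom (k : ℕ) : FreeGroup ℕ →* FreeGroup ℕ :=
  FreeGroup.lift fun t =>
    if t = k then of k * of (k + 1) * (of k)⁻¹ else if t = k + 1 then of k else of t

theorem artinHom_self (k : ℕ) : artinHom k (of k) = of (k + 1) := by simp [artinHom]

theorem artinHom_succ (k : ℕ) :
    artinHom k (of (k + 1)) = (of (k + 1))⁻¹ * of k * of (k + 1) := by simp [artinHom]

theorem artinHom_of_ne {k t : ℕ} (h : t ≠ k) (h' : t ≠ k + 1) : artinHom k (of t) = of t := by
  simp [artinHom, h, h']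

theorem artinInvHom_self (k : ℕ) : artinInvHom k (of k) = of k * of (k + 1) * (of k)⁻¹ := by
  simp [artinInvHom]

theorem artinInvHom_succ (k : ℕ) : artinInvHom k (of (k + 1)) = of k := by simp [artinInvHom]

theorem artinInvHom_of_ne {k t : ℕ} (h : t ≠ k) (h' : t ≠ k + 1) :
    artinInvHom k (of t) = of t := by
  simp [artinInvHom, h, h']

/-- The automorphism of the free group by which `σ_k` acts. -/
def artinAut (k : ℕ) : MulAut (FreeGroup ℕ) :=
  MonoidHom.toMulEquiv (artinHom k) (artinInvHom k)
    (by
      ext t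
      by_cases h : t = k
      · subst h; simp [artinHom_self, artinInvHom_succ]
      by_cases h' : t = k + 1
      · subst h'
        simp only [MonoidHom.comp_apply, artinHom_succ, _root_.map_mul, _root_.map_inv,
          artinInvHom_succ, artinInvHom_self, MonoidHom.id_apply]
        group
      · simp [artinHom_of_ne h h', artinInvHom_of_ne h h'])
    (by
      ext t
      by_cases h : t = k
      · subst h
        simp only [MonoidHom.comp_apply, artinHom_succ, _root_.map_mul, _root_.map_inv,
          artinHom_self, artinInvHom_self, MonoidHom.id_apply]
        group
      by_cases h' : t = k + 1
      · subst h'; simp [artinHom_self, artinInvHom_succ]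
      · simp [artinHom_of_ne h h', artinInvHom_of_ne h h'])

theorem artinAut_apply (k : ℕ) (x : FreeGroup ℕ) : artinAut k x = artinHom k x := rfl

theorem artinAut_inv_apply (k : ℕ) (x : FreeGroup ℕ) : (artinAut k)⁻¹ x = artinInvHom k x := rfl

theorem mulAut_ext_of {f g : MulAut (FreeGroup ℕ)} (h : ∀ t, f (of t) = g (of t)) : f = g :=
  MulEquiv.toMonoidHom_injective (FreeGroup.ext_hom _ _ h)

theorem artinAut_comm {k l : ℕ} (h : k + 2 ≤ l) : Commute (artinAut k) (artinAut l) := by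
  refine mulAut_ext_of fun t => ?_
  simp only [MulAut.mul_apply, artinAut_apply]
  have e1 := artinHom_of_ne (k := k) (t := l) (by omega) (by omega)
  have e2 := artinHom_of_ne (k := k) (t := l + 1) (by omega) (by omega)
  have e3 := artinHom_of_ne (k := l) (t := k) (by omega) (by omega)
  have e4 := artinHom_of_ne (k := l) (t := k + 1) (by omega) (by omega)
  by_cases h1 : t = k
  · subst h1; simp only [artinHom_self, e3, e4]
  by_cases h2 : t = k + 1
  · subst h2; simp only [artinHom_succ, e3, e4, _root_.map_mul, _root_.map_inv]
  by_cases h3 : t = l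
  · subst h3; simp only [artinHom_self, e1, e2]
  by_cases h4 : t = l + 1
  · subst h4; simp only [artinHom_succ, e1, e2, _root_.map_mul, _root_.map_inv]
  simp only [artinHom_of_ne h1 h2, artinHom_of_ne h3 h4]

theorem artinAut_braid (k : ℕ) :
    artinAut k * artinAut (k + 1) * artinAut k =
      artinAut (k + 1) * artinAut k * artinAut (k + 1) := by
  refine mulAut_ext_of fun t => ?_
  simp only [MulAut.mul_apply, artinAut_apply]
  have e1 := artinHom_of_ne (k := k) (t := k + 1 + 1) (by omega) (by omega)
  have e2 := artinHom_of_ne (k := k + 1) (t := k) (by omega) (by omega)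
  have s1 := artinHom_self k
  have s2 := artinHom_succ k
  have s3 := artinHom_self (k + 1)
  have s4 := artinHom_succ (k + 1)
  by_cases h1 : t = k
  · subst h1; simp only [e1, e2, s1, s3]
  by_cases h2 : t = k + 1
  · subst h2; simp only [e1, e2, s1, s2, s3, s4, _root_.map_mul, _root_.map_inv]
  by_cases h3 : t = k + 1 + 1
  · subst h3
    simp only [e1, e2, s2, s3, s4, _root_.map_mul, _root_.map_inv]
    group
  simp only [artinHom_of_ne h1 h2, artinHom_of_ne h2 h3]

theorem artinAut_rels (N : ℕ) (r : FreeGroup (Fin N)) (hr : r ∈ braidRels N) :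
    FreeGroup.lift (fun k : Fin N => artinAut ((k : ℕ) + 1)) r = 1 := by
  rcases hr with ⟨k, l, h, rfl⟩ | ⟨k, l, h, rfl⟩
  · simp only [_root_.map_mul, _root_.map_inv, FreeGroup.lift_apply_of]
    rw [mul_inv_eq_one, mul_inv_eq_iff_eq_mul]
    rcases h with h | h
    · exact artinAut_comm (by omega)
    · exact (artinAut_comm (by omega)).symm
  · simp only [_root_.map_mul, _root_.map_inv, FreeGroup.lift_apply_of, h]
    rw [mul_inv_eq_one, mul_inv_eq_iff_eq_mul, mul_inv_eq_iff_eq_mul]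
    exact artinAut_braid _

/-- The Artin action of the braid group on a free group. -/
def artinRep (N : ℕ) : BraidGroup N →* MulAut (FreeGroup ℕ) :=
  PresentedGroup.toGroup (artinAut_rels N)

variable {N : ℕ}

theorem artinRep_sgen {k : ℕ} (hk : 1 ≤ k) (hN : k ≤ N) : artinRep N (sgen N k) = artinAut k := by
  rw [sgen, dif_pos ⟨hk, hN⟩, artinRep, PresentedGroup.toGroup.of]
  simp only
  congr 1
  omega

theorem artinRep_agen_of_lt {i j t : ℕ} (hi : 1 ≤ i) (hij : i < j) (hjt : j < t)
    (hN : j ≤ N + 1) : artinRep N (agen N i j) (of t) = of t := by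
  have hs : ∀ k, 1 ≤ k → k < j → artinRep N (sgen N k) (of t) = of t := fun k h1 h2 => by
    rw [artinRep_sgen h1 (by omega), artinAut_apply, artinHom_of_ne (by omega) (by omega)]
  have hm : artinRep N (agen N i j) ∈ MulAction.stabilizer (MulAut (FreeGroup ℕ)) (of t) := by
    clear hjt
    induction j, hij using Nat.le_induction with
    | base =>
      rw [Nat.succ_eq_add_one, agen_self_succ, map_pow]
      exact pow_mem (hs i hi (by omega)) 2
    | succ j hj ih =>
      rw [agen_succ hj, _root_.map_mul, _root_.map_mul, _root_.map_inv]
      have hsj := hs j (by omega) (by omega)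
      exact mul_mem (mul_mem hsj (ih (by omega) fun k h1 h2 => hs k h1 (by omega))) (inv_mem hsj)
  exact hm

/-- The endomorphism of the free group killing `y_s` and fixing the other generators. -/
def kill (s : ℕ) : FreeGroup ℕ →* FreeGroup ℕ :=
  FreeGroup.lift fun t => if t = s then 1 else of t

theorem kill_self (s : ℕ) : kill s (of s) = 1 := by simp [kill]

theorem kill_of_ne {s t : ℕ} (h : t ≠ s) : kill s (of t) = of t := by simp [kill, h]

theorem kill_artinAut {s k : ℕ} (h : k + 1 < s) (x : FreeGroup ℕ) :
    kill s (artinAut k x) = artinAut k (kill s x) := by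
  suffices H : (kill s).comp (artinHom k) = (artinHom k).comp (kill s) from DFunLike.congr_fun H x
  ext t
  have e1 := kill_of_ne (s := s) (t := k) (by omega)
  have e2 := kill_of_ne (s := s) (t := k + 1) (by omega)
  simp only [MonoidHom.comp_apply]
  by_cases h1 : t = k
  · subst h1; simp only [artinHom_self, e1, e2]
  by_cases h2 : t = k + 1
  · subst h2; simp only [artinHom_succ, _root_.map_mul, _root_.map_inv, e1, e2]
  by_cases h3 : t = s
  · subst h3; simp only [artinHom_of_ne h1 h2, kill_self, _root_.map_one]
  simp only [artinHom_of_ne h1 h2, kill_of_ne h3]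

/-- `f` preserves `kill s`, and `f⁻¹` conjugates `y_s` by an element lying over `w`. -/
def Pushes (s : ℕ) (f : MulAut (FreeGroup ℕ)) (w : FreeGroup ℕ) : Prop :=
  (∀ x, kill s (f x) = kill s x) ∧
    ∃ c, f⁻¹ (of s) = c * of s * c⁻¹ ∧ kill s c = w

theorem Pushes.kill_inv {s : ℕ} {f : MulAut (FreeGroup ℕ)} {w : FreeGroup ℕ}
    (h : Pushes s f w) (x : FreeGroup ℕ) : kill s (f⁻¹ x) = kill s x := by
  rw [← h.1 (f⁻¹ x), MulAut.apply_inv_self]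

theorem Pushes.one (s : ℕ) : Pushes s 1 1 :=
  ⟨fun _ => rfl, 1, by simp, _root_.map_one _⟩

theorem Pushes.mul {s : ℕ} {f g : MulAut (FreeGroup ℕ)} {v w : FreeGroup ℕ}
    (hf : Pushes s f v) (hg : Pushes s g w) : Pushes s (f * g) (v * w) := by
  obtain ⟨c, hc, hcv⟩ := hf.2
  obtain ⟨d, hd, hdw⟩ := hg.2
  refine ⟨fun x => by rw [MulAut.mul_apply, hf.1, hg.1], g⁻¹ c * d, ?_, ?_⟩
  · rw [mul_inv_rev, MulAut.mul_apply, hc, _root_.map_mul, _root_.map_mul, _root_.map_inv, hd]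
    group
  · rw [_root_.map_mul, hg.kill_inv, hcv, hdw]

theorem Pushes.inv {s : ℕ} {f : MulAut (FreeGroup ℕ)} {w : FreeGroup ℕ}
    (h : Pushes s f w) : Pushes s f⁻¹ w⁻¹ := by
  obtain ⟨c, hc, hcw⟩ := h.2
  refine ⟨h.kill_inv, (f c)⁻¹, ?_, by rw [_root_.map_inv, h.1, hcw]⟩
  have e := congrArg f hc
  rw [MulAut.apply_inv_self, _root_.map_mul, _root_.map_mul, _root_.map_inv] at e
  rw [inv_inv]
  conv_rhs => rw [e]
  group

theorem pushes_agen {i s : ℕ} (hi : 1 ≤ i) (his : i < s) (hN : s ≤ N + 1) :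
    Pushes s (artinRep N (agen N i s)) (of i) := by
  obtain ⟨d, rfl⟩ := Nat.exists_eq_add_of_lt his
  induction d generalizing i with
  | zero =>
    rw [add_zero, agen_self_succ, map_pow, artinRep_sgen hi (by omega)]
    refine ⟨fun x => ?_, of i, ?_, kill_of_ne (by omega)⟩
    · suffices H : (kill (i + 1)).comp ((artinHom i).comp (artinHom i)) = kill (i + 1) from
        DFunLike.congr_fun H x
      ext t
      have e := kill_of_ne (s := i + 1) (t := i) (by omega)
      simp only [MonoidHom.comp_apply]
      by_cases h1 : t = i
      · subst h1
        simp [artinHom_self, artinHom_succ, e, kill_self]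
      by_cases h2 : t = i + 1
      · subst h2
        simp [artinHom_self, artinHom_succ, e, kill_self]
      simp only [artinHom_of_ne h1 h2]
    · rw [sq, mul_inv_rev, MulAut.mul_apply, artinAut_inv_apply, artinAut_inv_apply,
        artinInvHom_succ, artinInvHom_self]
  | succ d ih =>
    have e := ih (i := i + 1) (by omega) (by omega) (by omega)
    rw [show i + 1 + d + 1 = i + (d + 1) + 1 by omega] at e
    have hs := sgen_conj_agen (N := N) hi (show i + 1 < i + (d + 1) + 1 by omega) (by omega)
    have hc : agen N i (i + (d + 1) + 1) =
        (sgen N i)⁻¹ * agen N (i + 1) (i + (d + 1) + 1) * sgen N i := by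
      rw [← hs, MulAut.conj_apply]; group
    rw [hc, _root_.map_mul, _root_.map_mul, _root_.map_inv, artinRep_sgen hi (by omega)]
    generalize hS : i + (d + 1) + 1 = s at *
    generalize artinRep N (agen N (i + 1) s) = f at *
    have hk : ∀ x, kill s ((artinAut i)⁻¹ x) = (artinAut i)⁻¹ (kill s x) := fun x => by
      apply (artinAut i).injective
      rw [← kill_artinAut (by omega), MulAut.apply_inv_self, MulAut.apply_inv_self]
    obtain ⟨h1, c, h2, h3⟩ := e
    refine ⟨fun x => ?_, (artinAut i)⁻¹ c, ?_, ?_⟩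
    · rw [MulAut.mul_apply, MulAut.mul_apply, hk, h1, kill_artinAut (by omega),
        MulAut.inv_apply_self]
    · have hfix : artinAut i (of s) = of s := by
        rw [artinAut_apply, artinHom_of_ne (by omega) (by omega)]
      have hfix' : (artinAut i)⁻¹ (of s) = of s := by
        rw [artinAut_inv_apply, artinInvHom_of_ne (by omega) (by omega)]
      rw [mul_inv_rev, mul_inv_rev, inv_inv, MulAut.mul_apply, MulAut.mul_apply, hfix, h2,
        _root_.map_mul, _root_.map_mul, _root_.map_inv, hfix']
    · rw [hk, h3, artinAut_inv_apply, artinInvHom_succ]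

/-- The permutation action used to see that the centralizer of `y_s` is killed by `kill s`. -/
def swapAction (s : ℕ) : FreeGroup ℕ →* Equiv.Perm (FreeGroup ℕ × Bool) :=
  FreeGroup.lift fun t =>
    if t = s then Equiv.swap (1, false) (1, true)
    else Equiv.prodCongr (Equiv.mulLeft (of t)) (Equiv.refl Bool)

theorem swapAction_self (s : ℕ) :
    swapAction s (of s) = Equiv.swap ((1 : FreeGroup ℕ), false) (1, true) := by
  simp [swapAction]

theorem swapAction_of_fst (s t : ℕ) (z : FreeGroup ℕ × Bool) :
    (swapAction s (of t) z).1 = kill s (of t) * z.1 := by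
  by_cases h : t = s
  · subst h
    rw [swapAction_self, kill_self, one_mul, Equiv.swap_apply_def]
    split_ifs with h1 h2
    · rw [h1]
    · rw [h2]
    · rfl
  · rw [kill_of_ne h]
    simp [swapAction, h]

theorem swapAction_fst (s : ℕ) (c : FreeGroup ℕ) (z : FreeGroup ℕ × Bool) :
    (swapAction s c z).1 = kill s c * z.1 := by
  induction c using FreeGroup.induction_on generalizing z with
  | C1 => simp
  | of t => exact swapAction_of_fst s t z
  | inv_of t _ =>
    have h := swapAction_of_fst s t ((swapAction s (of t))⁻¹ z)
    rw [← Equiv.Perm.mul_apply, mul_inv_cancel, Equiv.Perm.one_apply] at h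
    rw [_root_.map_inv, _root_.map_inv, h, inv_mul_cancel_left]
  | mul a b ha hb => rw [_root_.map_mul, _root_.map_mul, Equiv.Perm.mul_apply, ha, hb, mul_assoc]

theorem kill_eq_one_of_commute {s : ℕ} {c : FreeGroup ℕ} (h : c * of s * c⁻¹ = of s) :
    kill s c = 1 := by
  by_contra hne
  have hc : swapAction s c * swapAction s (of s) = swapAction s (of s) * swapAction s c := by
    rw [← _root_.map_mul, ← _root_.map_mul, mul_inv_eq_iff_eq_mul.mp h]
  have h1 := Equiv.congr_fun hc (1, false)
  rw [Equiv.Perm.mul_apply, Equiv.Perm.mul_apply, swapAction_self, Equiv.swap_apply_left] at h1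
  have hf := swapAction_fst s c (1, false)
  rw [mul_one] at hf
  rw [Equiv.swap_apply_of_ne_of_ne (fun e => hne (by rw [← hf, e]))
    (fun e => hne (by rw [← hf, e]))] at h1
  simpa using (swapAction s c).injective h1

theorem Pushes.eq_one {s : ℕ} {f : MulAut (FreeGroup ℕ)} {w : FreeGroup ℕ} (h : Pushes s f w)
    (hf : f (of s) = of s) : w = 1 := by
  obtain ⟨_, c, h2, rfl⟩ := h
  refine kill_eq_one_of_commute (h2.symm.trans ?_)
  conv_lhs => rw [← hf]
  exact MulAut.inv_apply_self _ _ _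

end ArtinAction

section Presentation

variable {m n : ℕ}

theorem lift_commute_word {α G : Type*} [Group G] {f : α → G} {p q : α}
    (h : Commute (f p) (f q)) :
    FreeGroup.lift f ((of p)⁻¹ * of q * of p * (of q)⁻¹) = 1 := by
  simp only [_root_.map_mul, _root_.map_inv, FreeGroup.lift_apply_of]
  rw [mul_assoc _ _ (f p), ← h.eq]
  group

theorem lift_middle_word {α G : Type*} [Group G] {f : α → G} {x a b : α}
    (h : f b * f x * f a = f x * f a * f b) :
    FreeGroup.lift f ((of x)⁻¹ * of b * of x * (of a * of b * (of a)⁻¹)⁻¹) = 1 := by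
  simp only [_root_.map_mul, _root_.map_inv, FreeGroup.lift_apply_of]
  rw [mul_inv_eq_one, mul_assoc, inv_mul_eq_iff_eq_mul, eq_comm, ← mul_assoc, ← mul_assoc, ← h,
    mul_inv_cancel_right]

theorem lift_lower_word {α G : Type*} [Group G] {f : α → G} {x a b : α}
    (h1 : f x * (f a * f b) = f a * f b * f x) (h2 : f b * f x * f a = f x * f a * f b) :
    FreeGroup.lift f ((of x)⁻¹ * of a * of x *
      (of a * of b * of a * (of b)⁻¹ * (of a)⁻¹)⁻¹) = 1 := by
  simp only [_root_.map_mul, _root_.map_inv, FreeGroup.lift_apply_of]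
  generalize f x = x at *
  generalize f a = a at *
  generalize f b = b at *
  rw [mul_inv_eq_one]
  calc x⁻¹ * a * x = x⁻¹ * (a * b * x) * (x⁻¹ * b⁻¹ * x) := by group
    _ = a * b * (a * (b * x * a)⁻¹ * x) := by rw [← h1]; group
    _ = _ := by rw [h2]; group

theorem lift_crossed_word {α G : Type*} [Group G] {f : α → G} {x a b c : α}
    (h2 : f b * f x * f a = f x * f a * f b)
    (h3 : Commute (f c) (f b * f x * (f b)⁻¹)) :
    FreeGroup.lift f ((of x)⁻¹ * of c * of x *
      (of a * of b * (of a)⁻¹ * (of b)⁻¹ * of c * of b * of a * (of b)⁻¹ * (of a)⁻¹)⁻¹) = 1 := by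
  simp only [_root_.map_mul, _root_.map_inv, FreeGroup.lift_apply_of]
  generalize f x = x at *
  generalize f a = a at *
  generalize f b = b at *
  generalize f c = c at *
  have e : a * b * a⁻¹ * b⁻¹ = x⁻¹ * (b * x * b⁻¹) := by
    rw [eq_inv_mul_iff_mul_eq, ← mul_assoc, ← mul_assoc, ← mul_assoc, ← h2]
    group
  rw [mul_inv_eq_one, eq_comm]
  calc _ = (a * b * a⁻¹ * b⁻¹) * c * (a * b * a⁻¹ * b⁻¹)⁻¹ := by group
    _ = x⁻¹ * (b * x * b⁻¹ * c) * (b * x * b⁻¹)⁻¹ * x := by rw [e]; group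
    _ = _ := by rw [← h3.eq]; group

theorem agen_pureRels (r : FreeGroup (PureIdx m n)) (hr : r ∈ pureRels m n) :
    FreeGroup.lift (fun p : PureIdx m n => agen (m + n - 1) p.1.1 p.1.2) r = 1 := by
  rcases hr with ((⟨p, q, h, rfl⟩ | ⟨i, j, s, h, rfl⟩) | ⟨i, j, s, h, rfl⟩) | ⟨i, r, j, s, h, rfl⟩
  · obtain ⟨p1, p2, p3, p4⟩ := p.2
    obtain ⟨q1, q2, q3, q4⟩ := q.2
    refine lift_commute_word ?_
    rcases h with h | h
    · exact agen_commute_far p1 p2 h q2 (by omega)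
    · exact agen_commute_nested q1 h.1 p2 h.2 (by omega)
  · exact lift_middle_word (agen_triple h.1 h.2.1 h.2.2.2.1 (by omega)).2
  · have ht := agen_triple (N := m + n - 1) h.1 h.2.1 h.2.2.2.1 (by omega)
    exact lift_lower_word ht.1 ht.2
  · have h2 := (agen_triple (N := m + n - 1) (i := i) (j := j) (s := s) (by omega) (by omega)
      (by omega) (by omega)).2
    have h3 := agen_commute_crossed (N := m + n - 1) (i := i) (r := r) (j := j) (s := s)
      (by omega) (by omega) (by omega) (by omega) (by omega)
    exact lift_crossed_word h2 h3

/-- The homomorphism `x_{ij} ↦ a_{ij}`. -/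
def pureHom (m n : ℕ) : PresentedGroup (pureRels m n) →* BraidGroup (m + n - 1) :=
  PresentedGroup.toGroup agen_pureRels

theorem pureHom_of (p : PureIdx m n) :
    pureHom m n (PresentedGroup.of p) = agen (m + n - 1) p.1.1 p.1.2 :=
  PresentedGroup.toGroup.of agen_pureRels

/-- The subgroup generated by the `x_{is}` with fixed `s`. -/
def fiberSubgroup (m n s : ℕ) : Subgroup (PresentedGroup (pureRels m n)) :=
  Subgroup.closure {x | ∃ p : PureIdx m n, p.1.2 = s ∧ x = PresentedGroup.of p}

/-- The subgroup generated by the `x_{ij}` with `j ≤ s`. -/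
def lowerSubgroup (m n s : ℕ) : Subgroup (PresentedGroup (pureRels m n)) :=
  Subgroup.closure {x | ∃ p : PureIdx m n, p.1.2 ≤ s ∧ x = PresentedGroup.of p}

theorem of_mem_fiberSubgroup (p : PureIdx m n) :
    PresentedGroup.of p ∈ fiberSubgroup m n p.1.2 :=
  Subgroup.subset_closure ⟨p, rfl, rfl⟩

theorem mk_mem_fiberSubgroup {i s : ℕ} (h : 1 ≤ i ∧ i < s ∧ m + 1 ≤ s ∧ s ≤ m + n) :
    PresentedGroup.of (⟨(i, s), h⟩ : PureIdx m n) ∈ fiberSubgroup m n s :=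
  of_mem_fiberSubgroup (⟨(i, s), h⟩ : PureIdx m n)

theorem mk_eq_of_mul_inv_mem {α : Type*} {rels : Set (FreeGroup α)} {u v : FreeGroup α}
    (h : u * v⁻¹ ∈ rels) : PresentedGroup.mk rels u = PresentedGroup.mk rels v := by
  have h1 := PresentedGroup.one_of_mem h
  rwa [_root_.map_mul, _root_.map_inv, mul_inv_eq_one] at h1

theorem relation_commute (p q : PureIdx m n)
    (h : p.1.2 < q.1.1 ∨ (q.1.1 < p.1.1 ∧ p.1.2 < q.1.2)) :
    Commute (PresentedGroup.of (rels := pureRels m n) p) (PresentedGroup.of q) := by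
  have h1 := mk_eq_of_mul_inv_mem (rels := pureRels m n)
    (Or.inl (Or.inl (Or.inl ⟨p, q, h, rfl⟩)))
  rw [_root_.map_mul, _root_.map_mul, _root_.map_inv, mul_assoc, inv_mul_eq_iff_eq_mul] at h1
  exact h1.symm

theorem conj_fiber_triple {G : Type*} [Group G] {U : Subgroup G} {x a b : G} (ha : a ∈ U)
    (hb : b ∈ U) (h2 : x⁻¹ * b * x = a * b * a⁻¹)
    (h3 : x⁻¹ * a * x = a * b * a * b⁻¹ * a⁻¹) :
    (x⁻¹ * a * x ∈ U ∧ x * a * x⁻¹ ∈ U) ∧ (x⁻¹ * b * x ∈ U ∧ x * b * x⁻¹ ∈ U) := by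
  have hx : x⁻¹ * (a * b) * x = a * b := by
    calc _ = (x⁻¹ * a * x) * (x⁻¹ * b * x) := by group
      _ = _ := by rw [h2, h3]; group
  have hx' : x * (a * b) * x⁻¹ = a * b := by
    conv_lhs => rw [← hx]
    group
  have ha' : x * a * x⁻¹ = b⁻¹ * a * b := by
    have e : a = x * (a * b * a * b⁻¹ * a⁻¹) * x⁻¹ := by rw [← h3]; group
    have e2 : a = (a * b) * (x * a * x⁻¹) * (a * b)⁻¹ := by
      conv_lhs => rw [e]
      conv_rhs => rw [← hx']
      group
    have e3 : x * a * x⁻¹ = (a * b)⁻¹ * a * (a * b) := by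
      conv_rhs => enter [1, 2]; rw [e2]
      group
    rw [e3]; group
  have hb' : x * b * x⁻¹ = (x * a * x⁻¹)⁻¹ * (a * b) := by
    rw [← hx']; group
  have hA : x * a * x⁻¹ ∈ U := by
    rw [ha']; exact mul_mem (mul_mem (inv_mem hb) ha) hb
  refine ⟨⟨?_, hA⟩, ?_, ?_⟩
  · rw [h3]
    exact mul_mem (mul_mem (mul_mem (mul_mem ha hb) ha) (inv_mem hb)) (inv_mem ha)
  · rw [h2]; exact mul_mem (mul_mem ha hb) (inv_mem ha)
  · rw [hb']; exact mul_mem (inv_mem hA) (mul_mem ha hb)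

theorem conj_fiber_crossed {G : Type*} [Group G] {U : Subgroup G} {x a b c : G} (ha : a ∈ U)
    (hb : b ∈ U) (hc : c ∈ U) (ha' : x * a * x⁻¹ ∈ U) (hb' : x * b * x⁻¹ ∈ U)
    (h4 : x⁻¹ * c * x = a * b * a⁻¹ * b⁻¹ * c * b * a * b⁻¹ * a⁻¹) :
    x⁻¹ * c * x ∈ U ∧ x * c * x⁻¹ ∈ U := by
  constructor
  · rw [h4]
    have ha1 := inv_mem ha
    have hb1 := inv_mem hb
    exact mul_mem (mul_mem (mul_mem (mul_mem (mul_mem (mul_mem (mul_mem (mul_mem ha hb) ha1)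
      hb1) hc) hb) ha) hb1) ha1
  · set A := x * a * x⁻¹ with hA
    set B := x * b * x⁻¹ with hB
    have e : c = (A * B * A⁻¹ * B⁻¹) * (x * c * x⁻¹) * (A * B * A⁻¹ * B⁻¹)⁻¹ := by
      calc c = x * (x⁻¹ * c * x) * x⁻¹ := by group
        _ = _ := by rw [h4, hA, hB]; group
    have hk : A * B * A⁻¹ * B⁻¹ ∈ U :=
      mul_mem (mul_mem (mul_mem ha' hb') (inv_mem ha')) (inv_mem hb')
    have e' : x * c * x⁻¹ = (A * B * A⁻¹ * B⁻¹)⁻¹ * c * (A * B * A⁻¹ * B⁻¹) := by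
      conv_rhs => enter [1, 2]; rw [e]
      group
    rw [e']
    exact mul_mem (mul_mem (inv_mem hk) hc) hk

theorem conj_fiber_mem (p q : PureIdx m n) (h : p.1.2 < q.1.2) :
    (PresentedGroup.of p)⁻¹ * PresentedGroup.of q * PresentedGroup.of p ∈
        fiberSubgroup m n q.1.2 ∧
      PresentedGroup.of p * PresentedGroup.of q * (PresentedGroup.of p)⁻¹ ∈
        fiberSubgroup m n q.1.2 := by
  by_cases hfar : p.1.2 < q.1.1 ∨ (q.1.1 < p.1.1 ∧ p.1.2 < q.1.2)
  · have hc := relation_commute p q hfar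
    have e : (PresentedGroup.of p)⁻¹ * PresentedGroup.of q * PresentedGroup.of p =
        PresentedGroup.of (rels := pureRels m n) q := by
      rw [mul_assoc, ← hc.eq, inv_mul_cancel_left]
    rw [e, hc.eq, mul_inv_cancel_right]
    exact ⟨of_mem_fiberSubgroup q, of_mem_fiberSubgroup q⟩
  obtain ⟨⟨i, j⟩, hp⟩ := p
  obtain ⟨⟨r, s⟩, hq⟩ := q
  simp only at h hp hq hfar ⊢
  have hA := mk_mem_fiberSubgroup (m := m) (n := n) (i := i) (s := s) (by omega)
  have hB := mk_mem_fiberSubgroup (m := m) (n := n) (i := j) (s := s) (by omega)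
  have e2 := mk_eq_of_mul_inv_mem (rels := pureRels m n)
    (Or.inl (Or.inl (Or.inr ⟨i, j, s, by omega, rfl⟩)))
  have e3 := mk_eq_of_mul_inv_mem (rels := pureRels m n)
    (Or.inl (Or.inr ⟨i, j, s, by omega, rfl⟩))
  obtain ⟨tA, tB⟩ := conj_fiber_triple (G := PresentedGroup (pureRels m n))
    (x := PresentedGroup.mk (pureRels m n) (of (⟨(i, j), hp⟩ : PureIdx m n))) hA hB e2 e3
  by_cases hri : r = i
  · subst hri; exact tA
  by_cases hrj : r = j
  · subst hrj; exact tB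
  have e4 := mk_eq_of_mul_inv_mem (rels := pureRels m n)
    (Or.inr ⟨i, r, j, s, by omega, rfl⟩)
  exact conj_fiber_crossed hA hB (mk_mem_fiberSubgroup hq) tA.2 tB.2 e4

theorem mem_normalizer_closure {G : Type*} [Group G] {S : Set G} {x : G}
    (h : ∀ y ∈ S, x⁻¹ * y * x ∈ Subgroup.closure S ∧ x * y * x⁻¹ ∈ Subgroup.closure S) :
    x ∈ Subgroup.normalizer (Subgroup.closure S : Set G) := by
  have key : ∀ z : G, (∀ y ∈ S, z * y * z⁻¹ ∈ Subgroup.closure S) →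
      ∀ y ∈ Subgroup.closure S, z * y * z⁻¹ ∈ Subgroup.closure S := by
    intro z hz y hy
    have hle : Subgroup.closure S ≤
        (Subgroup.closure S).comap (MulAut.conj z).toMonoidHom :=
      (Subgroup.closure_le _).mpr hz
    exact hle hy
  refine Subgroup.mem_normalizer_iff.mpr fun y => ⟨key x (fun y hy => (h y hy).2) y, fun hy => ?_⟩
  have h' := key x⁻¹ (fun y hy => by rw [inv_inv]; exact (h y hy).1) _ hy
  rwa [show x⁻¹ * (x * y * x⁻¹) * x⁻¹⁻¹ = y by group] at h'

theorem lowerSubgroup_le_normalizer (s : ℕ) :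
    lowerSubgroup m n s ≤
      Subgroup.normalizer (fiberSubgroup m n (s + 1) : Set (PresentedGroup (pureRels m n))) := by
  refine (Subgroup.closure_le _).mpr ?_
  rintro _ ⟨p, hp, rfl⟩
  refine mem_normalizer_closure ?_
  rintro _ ⟨q, hq, rfl⟩
  have h := conj_fiber_mem p q (by omega)
  rw [hq] at h
  exact h

theorem exists_fiber_mul_lower {s : ℕ} {g : PresentedGroup (pureRels m n)}
    (hg : g ∈ lowerSubgroup m n (s + 1)) :
    ∃ u ∈ fiberSubgroup m n (s + 1), ∃ h ∈ lowerSubgroup m n s, u * h = g := by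
  have hle : lowerSubgroup m n (s + 1) ≤ fiberSubgroup m n (s + 1) ⊔ lowerSubgroup m n s := by
    refine (Subgroup.closure_le _).mpr ?_
    rintro _ ⟨p, hp, rfl⟩
    rcases Nat.lt_or_ge s p.1.2 with h | h
    · exact Subgroup.mem_sup_left (Subgroup.subset_closure ⟨p, by omega, rfl⟩)
    · exact Subgroup.mem_sup_right (Subgroup.subset_closure ⟨p, h, rfl⟩)
  have h := hle hg
  rw [← SetLike.mem_coe,
    Subgroup.coe_mul_of_right_le_normalizer_left _ _ (lowerSubgroup_le_normalizer s)] at h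
  exact Set.mem_mul.mp h

/-- The homomorphism `y_i ↦ x_{is}` from the free group onto the `s`-th fiber. -/
def fiberHom (m n s : ℕ) : FreeGroup ℕ →* PresentedGroup (pureRels m n) :=
  open Classical in
  FreeGroup.lift fun i =>
    if h : 1 ≤ i ∧ i < s ∧ m + 1 ≤ s ∧ s ≤ m + n then
      PresentedGroup.of (⟨(i, s), h⟩ : PureIdx m n) else 1

theorem fiberHom_of (p : PureIdx m n) :
    fiberHom m n p.1.2 (of p.1.1) = PresentedGroup.of p := by
  have hp := p.2
  rw [fiberHom, FreeGroup.lift_apply_of, dif_pos hp]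
  rfl

theorem exists_pushes {s : ℕ} {u : PresentedGroup (pureRels m n)}
    (hu : u ∈ fiberSubgroup m n s) :
    ∃ w, fiberHom m n s w = u ∧ Pushes s (artinRep (m + n - 1) (pureHom m n u)) w := by
  induction hu using Subgroup.closure_induction with
  | mem x hx =>
    obtain ⟨p, rfl, rfl⟩ := hx
    obtain ⟨h1, h2, h3, h4⟩ := p.2
    refine ⟨of p.1.1, fiberHom_of p, ?_⟩
    rw [pureHom_of]
    exact pushes_agen h1 h2 (by omega)
  | one =>
    refine ⟨1, _root_.map_one _, ?_⟩
    rw [_root_.map_one, _root_.map_one]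
    exact Pushes.one s
  | mul x y _ _ hx hy =>
    obtain ⟨v, rfl, hv⟩ := hx
    obtain ⟨w, rfl, hw⟩ := hy
    refine ⟨v * w, _root_.map_mul _ _ _, ?_⟩
    rw [_root_.map_mul, _root_.map_mul]
    exact hv.mul hw
  | inv x _ hx =>
    obtain ⟨v, rfl, hv⟩ := hx
    refine ⟨v⁻¹, _root_.map_inv _ _, ?_⟩
    rw [_root_.map_inv, _root_.map_inv]
    exact hv.inv

theorem artinRep_lower {s t : ℕ} (hst : s < t) {h : PresentedGroup (pureRels m n)}
    (hh : h ∈ lowerSubgroup m n s) :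
    artinRep (m + n - 1) (pureHom m n h) (of t) = of t := by
  have hle : lowerSubgroup m n s ≤
      (MulAction.stabilizer (MulAut (FreeGroup ℕ)) (of t)).comap
        ((artinRep (m + n - 1)).comp (pureHom m n)) := by
    refine (Subgroup.closure_le _).mpr ?_
    rintro _ ⟨p, hp, rfl⟩
    obtain ⟨h1, h2, h3, h4⟩ := p.2
    change artinRep (m + n - 1) (pureHom m n (PresentedGroup.of p)) (of t) = of t
    rw [pureHom_of]
    exact artinRep_agen_of_lt h1 h2 (by omega) (by omega)
  exact hle hh

theorem pureHom_injective_lower (s : ℕ) (g : PresentedGroup (pureRels m n))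
    (hg : g ∈ lowerSubgroup m n s) (h1 : pureHom m n g = 1) : g = 1 := by
  induction s generalizing g with
  | zero =>
    refine (Subgroup.closure_le ⊥).mpr ?_ hg
    rintro _ ⟨p, hp, rfl⟩
    have := p.2
    omega
  | succ s ih =>
    obtain ⟨u, hu, h, hh, rfl⟩ := exists_fiber_mul_lower hg
    obtain ⟨w, rfl, hw⟩ := exists_pushes hu
    have hfix := artinRep_lower (Nat.lt_succ_self s) hh
    have hu1 := congrArg (fun f => artinRep (m + n - 1) f (of (s + 1))) h1
    simp only [_root_.map_mul, _root_.map_one, MulAut.mul_apply, MulAut.one_apply] at hu1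
    rw [Nat.succ_eq_add_one] at hfix
    rw [hfix] at hu1
    have hw1 := hw.eq_one hu1
    subst hw1
    rw [_root_.map_one, one_mul] at h1 ⊢
    exact ih h hh h1

theorem pureHom_injective : Function.Injective (pureHom m n) := by
  refine (injective_iff_map_eq_one _).mpr fun g => pureHom_injective_lower (m + n) g ?_
  have htop : lowerSubgroup m n (m + n) = ⊤ := by
    rw [eq_top_iff, ← PresentedGroup.closure_range_of]
    refine Subgroup.closure_mono ?_
    rintro _ ⟨p, rfl⟩
    exact ⟨p, p.2.2.2.2, rfl⟩
  rw [htop]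
  exact Subgroup.mem_top g

end Presentation

section MixedBraids

variable {N m : ℕ}

theorem dprod_mul_sgen {i j : ℕ} (h : i + 2 ≤ j) :
    dprod N (i + 1) j * sgen N (i + 1) = dprod N i j := by
  induction j, h using Nat.le_induction with
  | base => rw [dprod_self_succ, dprod_succ (by omega), dprod_self_succ, one_mul, mul_one]
  | succ j hj ih => rw [dprod_succ (by omega), dprod_succ (by omega), mul_assoc, ih]

theorem dprod_mul_sgen_succ {i p j : ℕ} (hip : i < p) (hpj : p + 2 ≤ j) (hN : j ≤ N + 1) :
    dprod N i j * sgen N (p + 1) = sgen N p * dprod N i j := by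
  induction j, hpj using Nat.le_induction with
  | base =>
    have hc := dprod_comm (N := N) hip (k := p + 1) (by omega)
    rw [dprod_succ (by omega), dprod_succ hip, mul_assoc, mul_assoc, ← hc.eq, ← mul_assoc,
      ← mul_assoc, ← sgen_braid (by omega) (by omega)]
    group
  | succ j hj ih =>
    rw [dprod_succ (by omega), mul_assoc, ih (by omega), ← mul_assoc, ← mul_assoc,
      (sgen_comm (N := N) (k := p) (l := j) (by omega)).eq]

/-- The subgroup generated by the `a_{ij}` with `j > m`. -/
def mixedPure (N m : ℕ) : Subgroup (BraidGroup N) :=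
  Subgroup.closure {x | ∃ i j : ℕ, 1 ≤ i ∧ i < j ∧ m + 1 ≤ j ∧ j ≤ N + 1 ∧ x = agen N i j}

/-- The subgroup generated by the `a_{ij}` with `j > m` and the `σ_l` with `m < l < k`. -/
def mixedStage (N m k : ℕ) : Subgroup (BraidGroup N) :=
  Subgroup.closure
    ({x | ∃ i j : ℕ, 1 ≤ i ∧ i < j ∧ m + 1 ≤ j ∧ j ≤ N + 1 ∧ x = agen N i j} ∪
      {x | ∃ l : ℕ, m + 1 ≤ l ∧ l < k ∧ x = sgen N l})

theorem agen_mem_mixedPure {i j : ℕ} (hi : 1 ≤ i) (hij : i < j) (hj : m + 1 ≤ j)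
    (hN : j ≤ N + 1) : agen N i j ∈ mixedPure N m :=
  Subgroup.subset_closure ⟨i, j, hi, hij, hj, hN, rfl⟩

theorem mixedPure_le_mixedStage (k : ℕ) : mixedPure N m ≤ mixedStage N m k :=
  Subgroup.closure_mono Set.subset_union_left

theorem sgen_mem_mixedStage {l k : ℕ} (hl : m + 1 ≤ l) (hk : l < k) :
    sgen N l ∈ mixedStage N m k :=
  Subgroup.subset_closure (Or.inr ⟨l, hl, hk, rfl⟩)

theorem sgen_conj_agen_mem {i j k : ℕ} (hi : 1 ≤ i) (hij : i < j) (hj : m + 1 ≤ j)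
    (hN : j ≤ N + 1) (hk : m + 1 ≤ k) (hkN : k ≤ N) :
    (sgen N k)⁻¹ * agen N i j * sgen N k ∈ mixedPure N m ∧
      sgen N k * agen N i j * (sgen N k)⁻¹ ∈ mixedPure N m := by
  have hkk : agen N k (k + 1) ∈ mixedPure N m :=
    agen_mem_mixedPure (by omega) (by omega) (by omega) (by omega)
  have hleft : (sgen N k)⁻¹ * agen N i j * sgen N k ∈ mixedPure N m →
      (sgen N k)⁻¹ * agen N i j * sgen N k ∈ mixedPure N m ∧
        sgen N k * agen N i j * (sgen N k)⁻¹ ∈ mixedPure N m := by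
    intro h
    refine ⟨h, ?_⟩
    rw [sgen_conj_eq]
    exact mul_mem (mul_mem hkk h) (inv_mem hkk)
  have hright : sgen N k * agen N i j * (sgen N k)⁻¹ ∈ mixedPure N m →
      (sgen N k)⁻¹ * agen N i j * sgen N k ∈ mixedPure N m ∧
        sgen N k * agen N i j * (sgen N k)⁻¹ ∈ mixedPure N m := by
    intro h
    refine ⟨?_, h⟩
    rw [sgen_conj_eq] at h
    have h' := mul_mem (mul_mem (inv_mem hkk) h) hkk
    rwa [← mul_assoc, inv_mul_cancel_left, inv_mul_cancel_right] at h'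
  have hcomm : Commute (sgen N k) (agen N i j) →
      sgen N k * agen N i j * (sgen N k)⁻¹ ∈ mixedPure N m := by
    intro h
    rw [h.eq, mul_inv_cancel_right]
    exact agen_mem_mixedPure hi hij hj hN
  by_cases h1 : k = j
  · subst h1
    apply hright
    rw [← agen_succ hij]
    exact agen_mem_mixedPure hi (by omega) (by omega) (by omega)
  by_cases h2 : k = i
  · subst h2
    apply hright
    by_cases h3 : j = k + 1
    · subst h3
      apply hcomm
      rw [agen_self_succ]
      exact (Commute.refl _).pow_right 2
    · rw [← MulAut.conj_apply, sgen_conj_agen hi (by omega) hN]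
      exact agen_mem_mixedPure (by omega) (by omega) hj hN
  by_cases h3 : k + 1 = i
  · subst h3
    apply hleft
    rw [← sgen_conj_agen (N := N) (i := k) (j := j) (by omega) hij hN, MulAut.conj_apply]
    rw [← mul_assoc, inv_mul_cancel_left, inv_mul_cancel_right]
    exact agen_mem_mixedPure (by omega) (by omega) hj hN
  by_cases h4 : k + 1 = j
  · subst h4
    apply hleft
    rw [agen_succ (by omega), ← mul_assoc, inv_mul_cancel_left, inv_mul_cancel_right]
    exact agen_mem_mixedPure hi (by omega) hk (by omega)
  exact hright (hcomm (agen_comm hi hij hN (by omega)))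

theorem sgen_mem_normalizer {k : ℕ} (hk : m + 1 ≤ k) (hkN : k ≤ N) :
    sgen N k ∈ Subgroup.normalizer (mixedPure N m : Set (BraidGroup N)) := by
  refine mem_normalizer_closure ?_
  rintro _ ⟨i, j, hi, hij, hj, hN, rfl⟩
  exact sgen_conj_agen_mem hi hij hj hN hk hkN

theorem dprod_mem_normalizer {i j : ℕ} (hi : m ≤ i) (hij : i < j) (hN : j ≤ N + 1) :
    dprod N i j ∈ Subgroup.normalizer (mixedPure N m : Set (BraidGroup N)) := by
  induction j, hij using Nat.le_induction with
  | base => rw [Nat.succ_eq_add_one, dprod_self_succ]; exact one_mem _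
  | succ j hj ih =>
    rw [dprod_succ (by omega)]
    exact mul_mem (sgen_mem_normalizer (by omega) (by omega)) (ih (by omega))

/-- `g` lies in a coset `H_k σ_k ⋯ σ_{i+1}`, where `H_k` is `mixedStage N m k`. -/
def InStageCoset (N m k : ℕ) (g : BraidGroup N) : Prop :=
  ∃ h ∈ mixedStage N m k, ∃ i, m ≤ i ∧ i ≤ k ∧ g = h * dprod N i (k + 1)

theorem InStageCoset.mul_mixedPure {k : ℕ} {g a : BraidGroup N} (hkN : k ≤ N)
    (hg : InStageCoset N m k g) (ha : a ∈ mixedPure N m) : InStageCoset N m k (g * a) := by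
  obtain ⟨h, hh, i, hi, hik, rfl⟩ := hg
  have hd := dprod_mem_normalizer (N := N) (j := k + 1) hi (by omega) (by omega)
  have ha' := (Subgroup.mem_normalizer_iff.mp hd a).mp ha
  refine ⟨h * (dprod N i (k + 1) * a * (dprod N i (k + 1))⁻¹),
    mul_mem hh (mixedPure_le_mixedStage k ha'), i, hi, hik, by group⟩

theorem InStageCoset.mul_sgen {k l : ℕ} {g : BraidGroup N} (hkN : k ≤ N)
    (hg : InStageCoset N m k g) (hl : m + 1 ≤ l) (hlk : l ≤ k) :
    InStageCoset N m k (g * sgen N l) := by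
  obtain ⟨h, hh, i, hi, hik, rfl⟩ := hg
  rcases lt_trichotomy l i with hli | rfl | hli
  · refine ⟨h * sgen N l, mul_mem hh (sgen_mem_mixedStage hl (by omega)), i, hi, hik, ?_⟩
    rw [mul_assoc, mul_assoc, (dprod_comm (N := N) (j := k + 1) (by omega) (by omega)).eq]
  · obtain ⟨i, rfl⟩ : ∃ i, l = i + 1 := ⟨l - 1, by omega⟩
    refine ⟨h, hh, i, by omega, by omega, ?_⟩
    rw [mul_assoc, dprod_mul_sgen (by omega)]
  by_cases hl1 : l = i + 1
  · subst hl1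
    have hg : InStageCoset N m k (h * dprod N (i + 1) (k + 1)) :=
      ⟨h, hh, i + 1, by omega, by omega, rfl⟩
    have h2 := hg.mul_mixedPure hkN (a := agen N (i + 1) (i + 2))
      (agen_mem_mixedPure (by omega) (by omega) (by omega) (by omega))
    rw [agen_self_succ] at h2
    rwa [← dprod_mul_sgen (by omega), mul_assoc, mul_assoc, ← pow_two, ← mul_assoc]
  · obtain ⟨p, rfl⟩ : ∃ p, l = p + 1 := ⟨l - 1, by omega⟩
    refine ⟨h * sgen N p, mul_mem hh (sgen_mem_mixedStage (by omega) (by omega)), i, hi, hik, ?_⟩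
    rw [mul_assoc, mul_assoc, dprod_mul_sgen_succ (by omega) (by omega) (by omega)]

theorem InStageCoset.mul_sgen_inv {k l : ℕ} {g : BraidGroup N} (hkN : k ≤ N)
    (hg : InStageCoset N m k g) (hl : m + 1 ≤ l) (hlk : l ≤ k) :
    InStageCoset N m k (g * (sgen N l)⁻¹) := by
  have h := (hg.mul_sgen hkN hl hlk).mul_mixedPure hkN (a := (agen N l (l + 1))⁻¹)
    (inv_mem (agen_mem_mixedPure (by omega) (by omega) (by omega) (by omega)))
  rw [agen_self_succ] at h
  convert h using 1
  group

theorem inStageCoset_of_mem {k : ℕ} (hm : m ≤ k) (hkN : k ≤ N) {g : BraidGroup N}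
    (hg : g ∈ mixedStage N m (k + 1)) : InStageCoset N m k g := by
  induction hg using Subgroup.closure_induction_right with
  | one => exact ⟨1, one_mem _, k, hm, le_rfl, by rw [dprod_self_succ, one_mul]⟩
  | mul_right g _ y hy ih =>
    rcases hy with hy | ⟨l, hl, hlk, rfl⟩
    · exact ih.mul_mixedPure hkN (Subgroup.subset_closure hy)
    · exact ih.mul_sgen hkN hl (by omega)
  | mul_inv_cancel g _ y hy ih =>
    rcases hy with hy | ⟨l, hl, hlk, rfl⟩
    · exact ih.mul_mixedPure hkN (inv_mem (Subgroup.subset_closure hy))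
    · exact ih.mul_sgen_inv hkN hl (by omega)

variable {M : ℕ} {π : BraidGroup N →* Equiv.Perm (Fin M)}

theorem map_agen_eq_one
    (hπ : ∀ k, 1 ≤ k → k ≤ N → ∀ x, (π (sgen N k) x : ℕ) = Equiv.swap (k - 1) k (x : ℕ))
    {i j : ℕ} (hi : 1 ≤ i) (hij : i < j) (hN : j ≤ N + 1) : π (agen N i j) = 1 := by
  have hsq : π (sgen N i ^ 2) = 1 := by
    ext x
    rw [pow_two, _root_.map_mul, Equiv.Perm.mul_apply, hπ i hi (by omega), hπ i hi (by omega),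
      Equiv.swap_apply_self, Equiv.Perm.one_apply]
  rw [agen, _root_.map_mul, _root_.map_mul, hsq, mul_one, _root_.map_inv, mul_inv_cancel]

theorem mixedPure_le_ker
    (hπ : ∀ k, 1 ≤ k → k ≤ N → ∀ x, (π (sgen N k) x : ℕ) = Equiv.swap (k - 1) k (x : ℕ)) :
    mixedPure N m ≤ π.ker := by
  refine (Subgroup.closure_le _).mpr ?_
  rintro _ ⟨i, j, hi, hij, -, hN, rfl⟩
  exact map_agen_eq_one hπ hi hij hN

theorem mixedStage_fixes
    (hπ : ∀ k, 1 ≤ k → k ≤ N → ∀ x, (π (sgen N k) x : ℕ) = Equiv.swap (k - 1) k (x : ℕ))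
    {k : ℕ} (hkN : k ≤ N) {x : Fin M} (hx : (x : ℕ) = k) {g : BraidGroup N}
    (hg : g ∈ mixedStage N m k) : π g x = x := by
  have hle : mixedStage N m k ≤ (MulAction.stabilizer (Equiv.Perm (Fin M)) x).comap π := by
    refine (Subgroup.closure_le _).mpr ?_
    rintro _ (⟨i, j, hi, hij, -, hN, rfl⟩ | ⟨l, hl, hlk, rfl⟩)
    · change π (agen N i j) x = x
      rw [map_agen_eq_one hπ hi hij hN, Equiv.Perm.one_apply]
    · change π (sgen N l) x = x
      ext
      rw [hπ l (by omega) (by omega), Equiv.swap_apply_of_ne_of_ne (by omega) (by omega)]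
  exact hle hg

theorem map_dprod_apply
    (hπ : ∀ k, 1 ≤ k → k ≤ N → ∀ x, (π (sgen N k) x : ℕ) = Equiv.swap (k - 1) k (x : ℕ))
    {i k : ℕ} (hik : i ≤ k) (hkN : k ≤ N) {x : Fin M} (hx : (x : ℕ) = i) :
    (π (dprod N i (k + 1)) x : ℕ) = k := by
  induction k, hik using Nat.le_induction with
  | base => rw [dprod_self_succ, _root_.map_one, Equiv.Perm.one_apply, hx]
  | succ k hk ih =>
    rw [dprod_succ (by omega), _root_.map_mul, Equiv.Perm.mul_apply, hπ _ (by omega) hkN,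
      ih (by omega), Nat.add_sub_cancel, Equiv.swap_apply_left]

theorem mem_mixedPure_of_map_eq_one (hM : M = N + 1)
    (hπ : ∀ k, 1 ≤ k → k ≤ N → ∀ x, (π (sgen N k) x : ℕ) = Equiv.swap (k - 1) k (x : ℕ))
    {k : ℕ} (hk : m + 1 ≤ k) (hkN : k ≤ N + 1) {g : BraidGroup N}
    (hg : g ∈ mixedStage N m k) (hg1 : π g = 1) : g ∈ mixedPure N m := by
  induction k, hk using Nat.le_induction generalizing g with
  | base =>
    refine (Subgroup.closure_le _).mpr ?_ hg
    rintro _ (hx | ⟨l, hl, hlk, rfl⟩)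
    · exact Subgroup.subset_closure hx
    · omega
  | succ k hk ih =>
    obtain ⟨h, hh, i, hi, hik, rfl⟩ := inStageCoset_of_mem (by omega) (by omega) hg
    have hxi := map_dprod_apply hπ (x := ⟨i, by omega⟩) hik (by omega) rfl
    have hfix := mixedStage_fixes hπ (by omega) hxi hh
    rw [← Equiv.Perm.mul_apply, ← _root_.map_mul, hg1, Equiv.Perm.one_apply] at hfix
    rw [← hfix] at hxi
    obtain rfl : i = k := hxi
    rw [dprod_self_succ, mul_one] at hg1 ⊢
    exact ih (by omega) hh hg1

end MixedBraids

theorem range_pureHom (m n : ℕ) (hn : 1 ≤ n) :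
    (pureHom m n).range = mixedPure (m + n - 1) m := by
  rw [MonoidHom.range_eq_map, ← PresentedGroup.closure_range_of, MonoidHom.map_closure, mixedPure]
  congr 1
  ext x
  constructor
  · rintro ⟨_, ⟨p, rfl⟩, rfl⟩
    obtain ⟨h1, h2, h3, h4⟩ := p.2
    exact ⟨p.1.1, p.1.2, h1, h2, h3, by omega, pureHom_of p⟩
  · rintro ⟨i, j, hi, hij, hj, hN, rfl⟩
    exact ⟨_, ⟨⟨(i, j), hi, hij, hj, by omega⟩, rfl⟩, pureHom_of _⟩

theorem Bmn_eq_mixedStage (m n : ℕ) (hn : 1 ≤ n) :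
    Bmn m n = mixedStage (m + n - 1) m (m + n) := by
  rw [Bmn, mixedStage, BmnSet, Nat.sub_add_cancel (by omega)]
  congr 3
  ext x
  refine exists_congr fun k => ?_
  rw [Nat.le_sub_one_iff_lt (by omega)]

/-- Theorem 1: the group presented by the generators `x_{ij}` and relations P1–P4
is isomorphic to `P_{m,n} = B_{m,n} ⊓ ker π`, via `x_{ij} ↦ a_{ij}`. -/
theorem statement11 (m n : ℕ) (hm : 1 ≤ m) (hn : 1 ≤ n)
    (π : BraidGroup (m + n - 1) →* Equiv.Perm (Fin (m + n)))
    (hπ : ∀ k : ℕ, ∀ _hk1 : 1 ≤ k, ∀ _hk2 : k ≤ m + n - 1,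
      π (sgen (m + n - 1) k) =
        Equiv.swap (⟨k - 1, by omega⟩ : Fin (m + n)) (⟨k, by omega⟩ : Fin (m + n))) :
    ∃ φ : PresentedGroup (pureRels m n) ≃* ↥(Bmn m n ⊓ π.ker),
      ∀ p : PureIdx m n,
        (φ (PresentedGroup.of p) : BraidGroup (m + n - 1)) = agen (m + n - 1) p.1.1 p.1.2 := by
  have hπ' : ∀ k, 1 ≤ k → k ≤ m + n - 1 → ∀ x,
      (π (sgen (m + n - 1) k) x : ℕ) = Equiv.swap (k - 1) k (x : ℕ) := by
    intro k hk hkN x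
    rw [hπ k hk hkN]
    simp only [Equiv.swap_apply_def, Fin.ext_iff]
    split_ifs <;> rfl
  have hrange : (pureHom m n).range = Bmn m n ⊓ π.ker := by
    rw [range_pureHom m n hn, Bmn_eq_mixedStage m n hn]
    refine le_antisymm (le_inf (mixedPure_le_mixedStage _) (mixedPure_le_ker hπ')) ?_
    rintro g ⟨hg, hg1⟩
    exact mem_mixedPure_of_map_eq_one (by omega) hπ' (by omega) (by omega) hg hg1
  exact ⟨(MonoidHom.ofInjective pureHom_injective).trans (MulEquiv.subgroupCongr hrange),
    fun p => pureHom_of p⟩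

end BraidPaper
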